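/- Let E be a nonempty finite set, R_{ji} ≥ 0 (j, i ∈ E) a routing matrix, δ_{ji} ≥ 0 inter-link travel times, and let λ_i, c_i : [0,∞) → [0,∞) (i ∈ E) be locally piecewise constant and T-periodic. For k ≥ 1 let y_i^{(k)} : [0,∞) → [0,∞), x_i^{(k)}, z_i^{(k)} be such that: y_i^{(1)} = λ_i for all i; for each k and i, x_i^{(k)} is a T-periodic queue trajectory for (y_i^{(k)}, c_i) with outflow z_i^{(k)} (extended to all of ℝ by T-periodicity), and x_i^{(k)} is globally attractive, i.e., every queue trajectory x̂ for (y_i^{(k)}, c_i) satisfies |x̂(t) − x_i^{(k)}(t)| → 0 as t → ∞; and y_i^{(k+1)}(t) = λ_i(t) + Σ_{j ∈ E} R_{ji} z_j^{(k)}(t − δ_{ji}) for all i and t ≥ 0. Then for every k ≥ 1, every i ∈ E, and every t ≥ 0: z_i^{(k+1)}(t) ≥ z_i^{(k)}(t) and x_i^{(k+1)}(t) ≥ x_i^{(k)}(t). -/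

import Mathlib

open MeasureTheory

/-- `f` is piecewise constant on the set `s`: there is a finite set `D` of breakpoints
such that `f` is constant between consecutive breakpoints (pieces are right-open). -/
def PwcOn (f : ℝ → ℝ) (s : Set ℝ) : Prop :=
  ∃ D : Finset ℝ, ∀ u ∈ s, ∀ v ∈ s, u ≤ v → (∀ d ∈ D, d ∉ Set.Ioc u v) → f u = f v

/-- `f` is locally piecewise constant on `[0, ∞)`: piecewise constant on every compact
subinterval. -/
def LocPwc (f : ℝ → ℝ) : Prop :=
  ∀ a b : ℝ, PwcOn f (Set.Ici 0 ∩ Set.Icc a b)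

/-- The net rate of change of the queue: `y − c` when the queue is positive, and
`max (y − c) 0` when the queue is empty. -/
noncomputable def qrate (y c x : ℝ → ℝ) (r : ℝ) : ℝ :=
  if 0 < x r then y r - c r else max (y r - c r) 0

/-- `x` is a queue trajectory for inflow `y` and capacity `c`: it is nonnegative on
`[0, ∞)` and satisfies `x t = x 0 + ∫_0^t qrate` for every `t ≥ 0`. -/
def QueueTraj (y c x : ℝ → ℝ) : Prop :=
  (∀ t, 0 ≤ t → 0 ≤ x t) ∧
  ∀ t, 0 ≤ t → x t = x 0 + ∫ r in (0:ℝ)..t, qrate y c x r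

/-- The outflow of the queue trajectory `x` for `(y, c)`: the capacity when the queue is
positive, and `min y c` when the queue is empty. -/
noncomputable def outflow (y c x : ℝ → ℝ) (t : ℝ) : ℝ :=
  if 0 < x t then c t else min (y t) (c t)

/-- `α` is a transition point of the queue trajectory `x`: `x α = 0` and `x` is strictly
positive on some interval `(α, α + ε]`. -/
def TransitionPt (x : ℝ → ℝ) (α : ℝ) : Prop :=
  0 ≤ α ∧ x α = 0 ∧ ∃ ε > 0, ∀ t ∈ Set.Ioc α (α + ε), 0 < x t

/-- The `T`-periodic extension of `g : [0, ∞) → ℝ` to all of `ℝ`: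
`g t = g (t + n T)` for the least `n ∈ ℕ` with `t + n T ≥ 0`. -/
noncomputable def pext (T : ℝ) (g : ℝ → ℝ) (t : ℝ) : ℝ :=
  g (t + (⌈-t / T⌉₊ : ℝ) * T)

open Set Filter Topology

/-- `f` is measurable and bounded on `[0, ∞)`. -/
structure BddMeas (f : ℝ → ℝ) : Prop where
  measurable : Measurable fun t => f (max t 0)
  bounded : ∃ M, ∀ t, 0 ≤ t → |f t| ≤ M

/-- A piecewise constant function on `s` factors through a measurable map to a finite type. -/
lemma PwcOn.exists_factorization {f : ℝ → ℝ} {s : Set ℝ} (h : PwcOn f s) :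
    ∃ (D : Finset ℝ) (F : (D → Prop) → ℝ), ∀ u ∈ s, f u = F fun d => (d : ℝ) ≤ u := by
  classical
  obtain ⟨D, hD⟩ := h
  refine ⟨D, fun p => if hp : ∃ u ∈ s, (fun d : D => (d : ℝ) ≤ u) = p then f hp.choose else 0,
    fun u hu => ?_⟩
  have hp : ∃ v ∈ s, (fun d : D => (d : ℝ) ≤ v) = fun d : D => (d : ℝ) ≤ u := ⟨u, hu, rfl⟩
  beta_reduce
  rw [dif_pos hp]
  obtain ⟨hv, he⟩ := hp.choose_spec
  have key : ∀ d ∈ D, (d ≤ hp.choose ↔ d ≤ u) := fun d hd => iff_of_eq (congrFun he ⟨d, hd⟩)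
  rcases le_total u hp.choose with huv | huv
  · exact hD _ hu _ hv huv fun d hd hm => absurd ((key d hd).1 hm.2) (not_le.2 hm.1)
  · exact (hD _ hv _ hu huv fun d hd hm => absurd ((key d hd).2 hm.2) (not_le.2 hm.1)).symm

lemma periodic_add_nat_mul {f : ℝ → ℝ} {T : ℝ} (hT : 0 < T)
    (hper : ∀ t, 0 ≤ t → f (t + T) = f t) (n : ℕ) {t : ℝ} (ht : 0 ≤ t) :
    f (t + n * T) = f t := by
  induction n with
  | zero => simp
  | succ n ih =>
    rw [← ih, ← hper (t + n * T) (by positivity)]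
    push_cast
    ring_nf

lemma bddMeas_of_locPwc_of_periodic {f : ℝ → ℝ} {T : ℝ} (hT : 0 < T) (hf : LocPwc f)
    (hper : ∀ t, 0 ≤ t → f (t + T) = f t) : BddMeas f := by
  obtain ⟨D, F, hF⟩ := (hf 0 T).exists_factorization
  have hred : ∀ t, 0 ≤ t →
      f t = F fun d => (d : ℝ) ≤ t - (⌊t / T⌋₊ : ℝ) * T := by
    intro t ht
    have h1 : (⌊t / T⌋₊ : ℝ) * T ≤ t :=
      (le_div_iff₀ hT).1 (Nat.floor_le (div_nonneg ht hT.le))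
    have h2 : t < ((⌊t / T⌋₊ : ℝ) + 1) * T := (div_lt_iff₀ hT).1 (Nat.lt_floor_add_one _)
    have h3 : 0 ≤ t - (⌊t / T⌋₊ : ℝ) * T := by linarith
    rw [← hF _ ⟨h3, h3, by linarith⟩, ← periodic_add_nat_mul hT hper ⌊t / T⌋₊ h3,
      sub_add_cancel]
  refine ⟨?_, ?_⟩
  · have : (fun t => f (max t 0)) = F ∘ fun t => fun d : D =>
        (d : ℝ) ≤ max t 0 - (⌊max t 0 / T⌋₊ : ℝ) * T := by
      funext t
      exact hred _ (le_max_right _ _)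
    rw [this]
    refine (measurable_of_countable F).comp (measurable_pi_lambda _ fun d => ?_)
    exact measurableSet_setOfPred.1 (measurableSet_le measurable_const
      ((measurable_id.max measurable_const).sub (Measurable.mul_const
        ((measurable_of_countable fun n : ℕ => (n : ℝ)).comp
          (Nat.measurable_floor.comp ((measurable_id.max measurable_const).div_const T))) T)))
  · obtain ⟨M, hM⟩ := (Set.finite_range fun p => |F p|).bddAbove
    exact ⟨M, fun t ht => by rw [hred t ht]; exact hM ⟨_, rfl⟩⟩

lemma BddMeas.intervalIntegrable {f : ℝ → ℝ} (hf : BddMeas f) {a b : ℝ} (ha : 0 ≤ a)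
    (hb : 0 ≤ b) : IntervalIntegrable f volume a b := by
  obtain ⟨M, hM⟩ := hf.bounded
  have : IntervalIntegrable (fun t => f (max t 0)) volume a b := by
    refine (intervalIntegrable_const (c := M)).mono_fun hf.measurable.aestronglyMeasurable
      (ae_of_all _ fun t => ?_)
    exact (hM _ (le_max_right _ _)).trans (le_abs_self M)
  refine this.congr fun t ht => ?_
  have : 0 ≤ t := (le_min ha hb).trans ht.1.le
  simp [this]

lemma BddMeas.qrate {y c x : ℝ → ℝ} (hy : BddMeas y) (hc : BddMeas c)
    (hx : Measurable fun t => x (max t 0)) : BddMeas (qrate y c x) := by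
  obtain ⟨M, hM⟩ := hy.bounded
  obtain ⟨N, hN⟩ := hc.bounded
  refine ⟨?_, M + N, fun t ht => ?_⟩
  · exact Measurable.ite (measurableSet_lt measurable_const hx)
      (hy.measurable.sub hc.measurable) ((hy.measurable.sub hc.measurable).max measurable_const)
  · have h1 := abs_le.1 (hM t ht)
    have h2 := abs_le.1 (hN t ht)
    unfold _root_.qrate
    rw [abs_le]
    split_ifs
    · constructor <;> linarith
    · exact ⟨le_max_of_le_right (by linarith), max_le (by linarith) (by linarith)⟩

/-- The map `t ↦ ∫_0^t q` is measurable on `[0, ∞)` even when `q` is not integrable. -/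
lemma measurable_intervalIntegral_max (q : ℝ → ℝ) :
    Measurable fun t => ∫ r in (0:ℝ)..max t 0, q r := by
  classical
  set J : Set ℝ := {t | 0 ≤ t ∧ IntervalIntegrable q volume 0 t}
  have hmono : ∀ t ∈ J, ∀ s, 0 ≤ s → s ≤ t → s ∈ J := fun t ht s hs hst =>
    ⟨hs, ht.2.mono_set (by
      rw [uIcc_of_le hs, uIcc_of_le ht.1]; exact Icc_subset_Icc_right hst)⟩
  have hJm : MeasurableSet J :=
    OrdConnected.measurableSet ⟨fun a ha b hb t ht => hmono b hb t (ha.1.trans ht.1) ht.2⟩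
  have hcont : ContinuousOn (fun t => ∫ r in (0:ℝ)..t, q r) J := by
    intro t ht
    have hIcc : ∀ b ∈ J, ContinuousOn (fun t => ∫ r in (0:ℝ)..t, q r) (Icc 0 b) := by
      intro b hb
      have := intervalIntegral.continuousOn_primitive_interval
        ((intervalIntegrable_iff' (by simp)).1 hb.2)
      rwa [uIcc_of_le hb.1] at this
    by_cases hmax : ∃ b ∈ J, t < b
    · obtain ⟨b, hb, htb⟩ := hmax
      refine (hIcc b hb t ⟨ht.1, htb.le⟩).mono_of_mem_nhdsWithin ?_
      filter_upwards [self_mem_nhdsWithin, mem_nhdsWithin_of_mem_nhds (Iio_mem_nhds htb)]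
        with s hs hsb using ⟨hs.1, (mem_Iio.1 hsb).le⟩
    · push Not at hmax
      exact (hIcc t ht t ⟨ht.1, le_rfl⟩).mono fun s hs => ⟨hs.1, hmax s hs⟩
  have hpw : Measurable (J.piecewise (fun t => ∫ r in (0:ℝ)..t, q r) fun _ => 0) :=
    hcont.measurable_piecewise continuousOn_const hJm
  convert hpw.comp (measurable_id.max measurable_const) using 1
  funext t
  simp only [Function.comp, id]
  by_cases ht : max t 0 ∈ J
  · rw [piecewise_eq_of_mem _ _ _ ht]
  · rw [piecewise_eq_of_notMem _ _ _ ht]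
    exact intervalIntegral.integral_undef fun h => ht ⟨le_max_right _ _, h⟩

lemma QueueTraj.measurable {y c x : ℝ → ℝ} (h : QueueTraj y c x) :
    Measurable fun t => x (max t 0) := by
  have : (fun t => x (max t 0)) = fun t => x 0 + ∫ r in (0:ℝ)..max t 0, _root_.qrate y c x r :=
    funext fun t => h.2 _ (le_max_right _ _)
  rw [this]
  exact (measurable_intervalIntegral_max _).const_add _

lemma QueueTraj.bddMeas_qrate {y c x : ℝ → ℝ} (h : QueueTraj y c x) (hy : BddMeas y)
    (hc : BddMeas c) : BddMeas (qrate y c x) := hy.qrate hc h.measurable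

lemma QueueTraj.sub_eq_integral {y c x : ℝ → ℝ} (h : QueueTraj y c x) (hy : BddMeas y)
    (hc : BddMeas c) {s t : ℝ} (hs : 0 ≤ s) (ht : 0 ≤ t) :
    x t - x s = ∫ r in s..t, qrate y c x r := by
  have hq := h.bddMeas_qrate hy hc
  rw [h.2 t ht, h.2 s hs, ← intervalIntegral.integral_interval_sub_left
    (hq.intervalIntegrable le_rfl ht) (hq.intervalIntegrable le_rfl hs)]
  ring

lemma QueueTraj.continuousOn {y c x : ℝ → ℝ} (h : QueueTraj y c x) (hy : BddMeas y)
    (hc : BddMeas c) {b : ℝ} (hb : 0 ≤ b) : ContinuousOn x (Icc 0 b) := by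
  have := intervalIntegral.continuousOn_primitive_interval
    ((intervalIntegrable_iff' (by simp)).1
      ((h.bddMeas_qrate hy hc).intervalIntegrable le_rfl hb))
  rw [uIcc_of_le hb] at this
  exact (continuousOn_const.add this).congr fun t ht => h.2 t ht.1

/-- While a queue with smaller inflow is strictly longer, the gap does not increase. -/
lemma QueueTraj.sub_le_sub_of_lt {y y' c x x' : ℝ → ℝ} (h : QueueTraj y c x)
    (h' : QueueTraj y' c x') (hy : BddMeas y) (hy' : BddMeas y') (hc : BddMeas c)
    (hle : ∀ t, 0 ≤ t → y t ≤ y' t) {s t : ℝ} (hs : 0 ≤ s) (hst : s ≤ t)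
    (hlt : ∀ r ∈ Ioo s t, x' r < x r) : x t - x' t ≤ x s - x' s := by
  have ht := hs.trans hst
  have key : ∫ r in s..t, qrate y c x r ≤ ∫ r in s..t, qrate y' c x' r := by
    refine intervalIntegral.integral_mono_on_of_le_Ioo hst
      ((h.bddMeas_qrate hy hc).intervalIntegrable hs ht)
      ((h'.bddMeas_qrate hy' hc).intervalIntegrable hs ht) fun r hr => ?_
    have hr0 : 0 ≤ r := hs.trans hr.1.le
    have hpos : 0 < x r := (h'.1 r hr0).trans_lt (hlt r hr)
    have := hle r hr0
    unfold qrate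
    rw [if_pos hpos]
    split_ifs
    · linarith
    · exact le_max_of_le_left (by linarith)
  rw [← h.sub_eq_integral hy hc hs ht, ← h'.sub_eq_integral hy' hc hs ht] at key
  linarith

/-- Comparison principle: the order of two queues is preserved when the inflows are ordered. -/
lemma QueueTraj.le_of_le {y y' c x x' : ℝ → ℝ} (h : QueueTraj y c x)
    (h' : QueueTraj y' c x') (hy : BddMeas y) (hy' : BddMeas y') (hc : BddMeas c)
    (hle : ∀ t, 0 ≤ t → y t ≤ y' t) {s t : ℝ} (hs : 0 ≤ s) (hst : s ≤ t)
    (hxs : x s ≤ x' s) : x t ≤ x' t := by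
  have ht := hs.trans hst
  set S : Set ℝ := {r ∈ Icc s t | x r ≤ x' r}
  have hsub : Icc s t ⊆ Icc 0 t := Icc_subset_Icc_left hs
  have hScl : IsClosed S := isClosed_Icc.isClosed_le ((h.continuousOn hy hc ht).mono hsub)
    ((h'.continuousOn hy' hc ht).mono hsub)
  have hbdd : BddAbove S := ⟨t, fun r hr => hr.1.2⟩
  have hmem : sSup S ∈ S := hScl.csSup_mem ⟨s, ⟨le_rfl, hst⟩, hxs⟩ hbdd
  have := h.sub_le_sub_of_lt h' hy hy' hc hle (hs.trans hmem.1.1) hmem.1.2 fun r hr => by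
    by_contra! hcon
    exact not_le.2 hr.1 (le_csSup hbdd ⟨⟨hmem.1.1.trans hr.1.le, hr.2.le⟩, hcon⟩)
  linarith [hmem.2]

/-- Lowering a queue trajectory that is bounded away from zero gives a queue trajectory. -/
lemma QueueTraj.sub_const {y c x : ℝ → ℝ} (h : QueueTraj y c x) {d : ℝ} (hd : 0 ≤ d)
    (hdx : ∀ t, 0 ≤ t → d < x t) : QueueTraj y c fun t => x t - d := by
  refine ⟨fun t ht => (sub_pos.2 (hdx t ht)).le, fun t ht => ?_⟩
  have : ∫ r in (0:ℝ)..t, qrate y c (fun t => x t - d) r = ∫ r in (0:ℝ)..t, qrate y c x r := by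
    refine intervalIntegral.integral_congr fun r hr => ?_
    rw [uIcc_of_le ht] at hr
    have := hdx r hr.1
    simp only [qrate]
    rw [if_pos (sub_pos.2 this), if_pos (hd.trans_lt this)]
  simp only
  rw [this, h.2 t ht]
  ring

/-- Periodic trajectories are monotone in the inflow if the lower one is attractive. -/
lemma QueueTraj.le_of_periodic_of_attractive {y y' c x x' : ℝ → ℝ} {T : ℝ} (hT : 0 < T)
    (h : QueueTraj y c x) (h' : QueueTraj y' c x') (hy : BddMeas y) (hy' : BddMeas y')
    (hc : BddMeas c) (hle : ∀ t, 0 ≤ t → y t ≤ y' t)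
    (hper : ∀ t, 0 ≤ t → x (t + T) = x t) (hper' : ∀ t, 0 ≤ t → x' (t + T) = x' t)
    (hattr : ∀ xh : ℝ → ℝ, QueueTraj y c xh → Tendsto (fun t => |xh t - x t|) atTop (𝓝 0))
    {t : ℝ} (ht : 0 ≤ t) : x t ≤ x' t := by
  have hlarge : ∀ s : ℝ, ∃ n : ℕ, s ≤ n * T := fun s => by
    obtain ⟨n, hn⟩ := exists_nat_ge (s / T)
    exact ⟨n, (div_le_iff₀ hT).1 hn⟩
  by_cases hex : ∃ s, 0 ≤ s ∧ x s ≤ x' s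
  · obtain ⟨s, hs, hxs⟩ := hex
    obtain ⟨n, hn⟩ := hlarge s
    rw [← periodic_add_nat_mul hT hper n ht, ← periodic_add_nat_mul hT hper' n ht]
    exact h.le_of_le h' hy hy' hc hle hs (by linarith) hxs
  · push Not at hex
    exfalso
    have hd : 0 < x 0 - x' 0 := sub_pos.2 (hex 0 le_rfl)
    have hgap : ∀ s, 0 ≤ s → x 0 - x' 0 ≤ x s := fun s hs => by
      obtain ⟨n, hn⟩ := hlarge s
      have := h.sub_le_sub_of_lt h' hy hy' hc hle hs hn fun r hr => hex r (hs.trans hr.1.le)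
      have h1 := periodic_add_nat_mul hT hper n le_rfl
      have h2 := periodic_add_nat_mul hT hper' n le_rfl
      rw [zero_add] at h1 h2
      linarith [h'.1 s hs]
    have hlim := hattr _ (h.sub_const (half_pos hd).le fun s hs => by linarith [hgap s hs])
    have hconst : (fun t => |x t - (x 0 - x' 0) / 2 - x t|) = fun _ => (x 0 - x' 0) / 2 := by
      funext t
      rw [sub_sub_cancel_left, abs_neg, abs_of_pos (half_pos hd)]
    rw [hconst] at hlim
    linarith [tendsto_nhds_unique hlim tendsto_const_nhds]

lemma outflow_nonneg {y c x : ℝ → ℝ} {t : ℝ} (hy : 0 ≤ y t) (hc : 0 ≤ c t) :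
    0 ≤ outflow y c x t := by
  unfold outflow
  split_ifs
  exacts [hc, le_min hy hc]

lemma outflow_le_capacity (y c x : ℝ → ℝ) (t : ℝ) : outflow y c x t ≤ c t := by
  unfold outflow
  split_ifs
  exacts [le_rfl, min_le_right _ _]

lemma outflow_mono {y y' c x x' : ℝ → ℝ} {t : ℝ} (hy : y t ≤ y' t) (hx : x t ≤ x' t) :
    outflow y c x t ≤ outflow y' c x' t := by
  by_cases h' : 0 < x' t
  · have : outflow y' c x' t = c t := if_pos h'
    exact this ▸ outflow_le_capacity _ _ _ _
  · have h : ¬ 0 < x t := fun h => h' (h.trans_le hx)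
    unfold outflow
    rw [if_neg h, if_neg h']
    exact min_le_min_right _ hy

lemma QueueTraj.bddMeas_outflow {y c x : ℝ → ℝ} (h : QueueTraj y c x) (hy : BddMeas y)
    (hc : BddMeas c) (hy0 : ∀ t, 0 ≤ t → 0 ≤ y t) (hc0 : ∀ t, 0 ≤ t → 0 ≤ c t) :
    BddMeas (outflow y c x) := by
  obtain ⟨M, hM⟩ := hc.bounded
  refine ⟨Measurable.ite (measurableSet_lt measurable_const h.measurable) hc.measurable
    (hy.measurable.min hc.measurable), M, fun t ht => ?_⟩
  rw [abs_of_nonneg (outflow_nonneg (hy0 t ht) (hc0 t ht))]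
  exact (outflow_le_capacity _ _ _ _).trans ((le_abs_self _).trans (hM t ht))

lemma pext_arg_nonneg {T : ℝ} (hT : 0 < T) (t : ℝ) : 0 ≤ t + (⌈-t / T⌉₊ : ℝ) * T := by
  have := (div_le_iff₀ hT).1 (Nat.le_ceil (-t / T))
  linarith

lemma BddMeas.pext_sub {g : ℝ → ℝ} (hg : BddMeas g) {T : ℝ} (hT : 0 < T) (d : ℝ) :
    BddMeas fun t => pext T g (t - d) := by
  obtain ⟨M, hM⟩ := hg.bounded
  refine ⟨?_, M, fun t _ => hM _ (pext_arg_nonneg hT _)⟩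
  have : pext T g = fun t => g (max (t + (⌈-t / T⌉₊ : ℝ) * T) 0) := by
    funext t
    rw [max_eq_left (pext_arg_nonneg hT t), pext]
  have hm : Measurable (pext T g) := by
    rw [this]
    refine hg.measurable.comp (measurable_id.add (Measurable.mul_const ?_ T))
    exact (measurable_of_countable fun n : ℕ => (n : ℝ)).comp
      (Nat.measurable_ceil.comp (measurable_id.neg.div_const T))
  exact hm.comp ((measurable_id.max measurable_const).sub_const d)

lemma BddMeas.add {f g : ℝ → ℝ} (hf : BddMeas f) (hg : BddMeas g) :
    BddMeas fun t => f t + g t := by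
  obtain ⟨M, hM⟩ := hf.bounded
  obtain ⟨N, hN⟩ := hg.bounded
  exact ⟨hf.measurable.add hg.measurable, M + N, fun t ht =>
    (abs_add_le _ _).trans (add_le_add (hM t ht) (hN t ht))⟩

lemma BddMeas.const_mul {f : ℝ → ℝ} (hf : BddMeas f) (a : ℝ) : BddMeas fun t => a * f t := by
  obtain ⟨M, hM⟩ := hf.bounded
  exact ⟨hf.measurable.const_mul a, |a| * M, fun t ht => by
    rw [abs_mul]; exact mul_le_mul_of_nonneg_left (hM t ht) (abs_nonneg a)⟩

lemma BddMeas.sum {ι : Type*} (s : Finset ι) {f : ι → ℝ → ℝ} (hf : ∀ i, BddMeas (f i)) :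
    BddMeas fun t => ∑ i ∈ s, f i t := by
  classical
  induction s using Finset.induction_on with
  | empty => exact ⟨by simp, 0, by simp⟩
  | insert i s hi ih =>
    simp only [Finset.sum_insert hi]
    exact (hf i).add ih

lemma BddMeas.congr {f g : ℝ → ℝ} (hf : BddMeas f) (h : ∀ t, 0 ≤ t → g t = f t) :
    BddMeas g := by
  obtain ⟨M, hM⟩ := hf.bounded
  refine ⟨?_, M, fun t ht => h t ht ▸ hM t ht⟩
  convert hf.measurable using 2 with t
  exact h _ (le_max_right _ _)

/-- Monotonicity of the iterates of the network steady-state computation: each link's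
inflow at stage `k + 1` is the external inflow plus the routed, delayed outflows of
stage `k`; then the outflows and queue lengths are monotonically non-decreasing in `k`. -/
theorem network_iterates_monotone {E : Type*} [Fintype E] [Nonempty E]
    (R δ : E → E → ℝ) (T : ℝ) (lam c : E → ℝ → ℝ)
    (y : ℕ → E → ℝ → ℝ) (x : ℕ → E → ℝ → ℝ)
    (hT : 0 < T) (hRnn : ∀ j i, 0 ≤ R j i) (hδnn : ∀ j i, 0 ≤ δ j i)
    (hlam_nn : ∀ i, ∀ t, 0 ≤ t → 0 ≤ lam i t) (hc_nn : ∀ i, ∀ t, 0 ≤ t → 0 ≤ c i t)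
    (hlam_pwc : ∀ i, LocPwc (lam i)) (hc_pwc : ∀ i, LocPwc (c i))
    (hlam_per : ∀ i, ∀ t, 0 ≤ t → lam i (t + T) = lam i t)
    (hc_per : ∀ i, ∀ t, 0 ≤ t → c i (t + T) = c i t)
    (hy_nn : ∀ k, 1 ≤ k → ∀ i, ∀ t, 0 ≤ t → 0 ≤ y k i t)
    (hy1 : ∀ i, ∀ t, 0 ≤ t → y 1 i t = lam i t)
    (hqt : ∀ k, 1 ≤ k → ∀ i, QueueTraj (y k i) (c i) (x k i))
    (hx_per : ∀ k, 1 ≤ k → ∀ i, ∀ t, 0 ≤ t → x k i (t + T) = x k i t)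
    (hx_attr : ∀ k, 1 ≤ k → ∀ i, ∀ xh : ℝ → ℝ, QueueTraj (y k i) (c i) xh →
      Filter.Tendsto (fun t => |xh t - x k i t|) Filter.atTop (nhds 0))
    (hrec : ∀ k, 1 ≤ k → ∀ i, ∀ t, 0 ≤ t →
      y (k + 1) i t = lam i t +
        ∑ j, R j i * pext T (outflow (y k j) (c j) (x k j)) (t - δ j i)) :
    ∀ k, 1 ≤ k → ∀ i, ∀ t, 0 ≤ t →
      outflow (y k i) (c i) (x k i) t ≤ outflow (y (k + 1) i) (c i) (x (k + 1) i) t ∧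
      x k i t ≤ x (k + 1) i t := by
  have hlam : ∀ i, BddMeas (lam i) := fun i =>
    bddMeas_of_locPwc_of_periodic hT (hlam_pwc i) (hlam_per i)
  have hc : ∀ i, BddMeas (c i) := fun i =>
    bddMeas_of_locPwc_of_periodic hT (hc_pwc i) (hc_per i)
  have hy : ∀ k, 1 ≤ k → ∀ i, BddMeas (y k i) := by
    intro k hk
    induction k, hk using Nat.le_induction with
    | base => exact fun i => (hlam i).congr (hy1 i)
    | succ k hk ih =>
      exact fun i => ((hlam i).add (BddMeas.sum Finset.univ fun j =>
        (((hqt k hk j).bddMeas_outflow (ih j) (hc j) (hy_nn k hk j) (hc_nn j)).pext_sub hT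
          (δ j i)).const_mul (R j i))).congr (hrec k hk i)
  have hx : ∀ k, 1 ≤ k → (∀ i t, 0 ≤ t → y k i t ≤ y (k + 1) i t) →
      ∀ i t, 0 ≤ t → x k i t ≤ x (k + 1) i t := fun k hk hle i t ht =>
    have hk' : 1 ≤ k + 1 := hk.trans k.le_succ
    (hqt k hk i).le_of_periodic_of_attractive hT (hqt _ hk' i) (hy k hk i) (hy _ hk' i) (hc i)
      (hle i) (hx_per k hk i) (hx_per _ hk' i) (hx_attr k hk i) ht
  have hymono : ∀ k, 1 ≤ k → ∀ i t, 0 ≤ t → y k i t ≤ y (k + 1) i t := by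
    intro k hk
    induction k, hk using Nat.le_induction with
    | base =>
      intro i t ht
      rw [hy1 i t ht, hrec 1 le_rfl i t ht]
      refine le_add_of_nonneg_right (Finset.sum_nonneg fun j _ => mul_nonneg (hRnn j i) ?_)
      exact outflow_nonneg (hy_nn 1 le_rfl j _ (pext_arg_nonneg hT _))
        (hc_nn j _ (pext_arg_nonneg hT _))
    | succ k hk ih =>
      intro i t ht
      rw [hrec k hk i t ht, hrec (k + 1) (hk.trans k.le_succ) i t ht]
      gcongr with j
      · exact hRnn j i
      · exact outflow_mono (ih j _ (pext_arg_nonneg hT _))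
          (hx k hk ih j _ (pext_arg_nonneg hT _))
  intro k hk i t ht
  have hxt := hx k hk (hymono k hk) i t ht
  exact ⟨outflow_mono (hymono k hk i t ht) hxt, hxt⟩
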